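/- Let P(λ) = A_m λ^m + ⋯ + A_1 λ + A_0 be an n×n complex matrix polynomial with det A_m ≠ 0, with nonnegative weights w_0, …, w_m, w_0 > 0, w(t) = Σ w_j t^j, and let λ0 be an eigenvalue of P. Suppose there exist integers p0 ≥ 1, κ0 ≥ 1 with κ0·p0 ≤ nm, matrices X ∈ ℂ^{n×nm}, Y ∈ ℂ^{nm×n}, and J = J_1 ⊕ ⋯ ⊕ J_{κ0} ⊕ J̃ ∈ ℂ^{nm×nm}, where each J_i = λ0 I_{p0} + N with N the p0×p0 nilpotent Jordan block (ones on the superdiagonal, zeros elsewhere) and J̃ is an (nm − κ0 p0)×(nm − κ0 p0) matrix, such that: (i) P(μ)^{−1} = X (μ I_{nm} − J)^{−1} Y for every μ ∈ ℂ with det P(μ) ≠ 0; (ii) (μ − λ0)^{p0} (μ I − J̃)^{−1} → 0 as μ → λ0; and (iii) K := w(|λ0|) · ‖X D Y‖ > 0, where D = N^{p0−1} ⊕ ⋯ ⊕ N^{p0−1} ⊕ 0 (κ0 copies of N^{p0−1} followed by the zero block of size nm − κ0 p0). For ε > 0 let G_ε be the connected component of the ε-pseudospectrum σ_ε(P) containing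 λ0. Then the Hausdorff distance between G_ε and the closed disc {μ ∈ ℂ : |μ − λ0| ≤ (K ε)^{1/p0}} is o(ε^{1/p0}) as ε → 0⁺. -/

import Mathlib

noncomputable section

open Matrix

/-- Euclidean norm of a complex vector. -/
def enorm2 {n : ℕ} (x : Fin n → ℂ) : ℝ := Real.sqrt (∑ i, ‖x i‖ ^ 2)

/-- Spectral norm: the operator norm induced by the Euclidean vector norm. -/
def specNorm {n : ℕ} (A : Matrix (Fin n) (Fin n) ℂ) : ℝ :=
  sSup {r : ℝ | ∃ x : Fin n → ℂ, enorm2 x = 1 ∧ r = enorm2 (A.mulVec x)}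

/-- Smallest singular value: the minimum of `‖A x‖` over Euclidean-unit vectors `x`. -/
def sminSV {n : ℕ} (A : Matrix (Fin n) (Fin n) ℂ) : ℝ :=
  sInf {r : ℝ | ∃ x : Fin n → ℂ, enorm2 x = 1 ∧ r = enorm2 (A.mulVec x)}

/-- Evaluation of the matrix polynomial `P(z) = ∑ A_j z^j`. -/
def evalP {n m : ℕ} (A : Fin (m+1) → Matrix (Fin n) (Fin n) ℂ) (z : ℂ) :
    Matrix (Fin n) (Fin n) ℂ :=
  ∑ j : Fin (m+1), z ^ (j : ℕ) • A j

/-- Derivative `P'(z) = ∑_{j≥1} j A_j z^(j-1)`. -/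
def derivP {n m : ℕ} (A : Fin (m+1) → Matrix (Fin n) (Fin n) ℂ) (z : ℂ) :
    Matrix (Fin n) (Fin n) ℂ :=
  ∑ j : Fin (m+1), (((j : ℕ) : ℂ) * z ^ ((j : ℕ) - 1)) • A j

/-- The scalar polynomial `det P(λ)`. -/
def detPoly {n m : ℕ} (A : Fin (m+1) → Matrix (Fin n) (Fin n) ℂ) : Polynomial ℂ :=
  (Matrix.of fun i k => ∑ j : Fin (m+1), Polynomial.C (A j i k) * Polynomial.X ^ (j : ℕ)).det

/-- The weight polynomial `w(t) = ∑ w_j t^j`. -/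
def wval {m : ℕ} (w : Fin (m+1) → ℝ) (t : ℝ) : ℝ := ∑ j : Fin (m+1), w j * t ^ (j : ℕ)

/-- The `p × p` nilpotent Jordan block (ones on the superdiagonal). -/
def jordanN (p : ℕ) : Matrix (Fin p) (Fin p) ℂ :=
  Matrix.of fun a b => if (b : ℕ) = (a : ℕ) + 1 then 1 else 0

/-- `J = J_1 ⊕ ⋯ ⊕ J_{κ0} ⊕ J̃` with `κ0` Jordan blocks `λ0 I + N` of size `p0`. -/
def bigJ (lam0 : ℂ) (p0 κ0 q : ℕ) (Jt : Matrix (Fin q) (Fin q) ℂ) :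
    Matrix ((Fin p0 × Fin κ0) ⊕ Fin q) ((Fin p0 × Fin κ0) ⊕ Fin q) ℂ :=
  Matrix.fromBlocks
    (Matrix.blockDiagonal fun _ : Fin κ0 => lam0 • (1 : Matrix (Fin p0) (Fin p0) ℂ) + jordanN p0)
    0 0 Jt

/-- `D = N^{p0−1} ⊕ ⋯ ⊕ N^{p0−1} ⊕ 0` (`κ0` copies, then a zero block of size `q`). -/
def bigD (p0 κ0 q : ℕ) :
    Matrix ((Fin p0 × Fin κ0) ⊕ Fin q) ((Fin p0 × Fin κ0) ⊕ Fin q) ℂ :=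
  Matrix.fromBlocks
    (Matrix.blockDiagonal fun _ : Fin κ0 => (jordanN p0) ^ (p0 - 1))
    0 0 0

section helpers
open Filter Topology

def opN {n : ℕ} (A : Matrix (Fin n) (Fin n) ℂ) : ℝ :=
  ‖Matrix.toEuclideanCLM (n := Fin n) (𝕜 := ℂ) A‖

lemma enorm2_eq {n : ℕ} (x : Fin n → ℂ) :
    enorm2 x = ‖(WithLp.toLp 2 x : EuclideanSpace ℂ (Fin n))‖ := by
  rw [EuclideanSpace.norm_eq]; rfl

lemma enorm2_smul {n : ℕ} (c : ℂ) (x : Fin n → ℂ) : enorm2 (c • x) = ‖c‖ * enorm2 x := by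
  rw [enorm2_eq, enorm2_eq, WithLp.toLp_smul, norm_smul]

lemma enorm2_nonneg {n : ℕ} (x : Fin n → ℂ) : 0 ≤ enorm2 x := Real.sqrt_nonneg _

lemma enorm2_pos {n : ℕ} {x : Fin n → ℂ} (hx : x ≠ 0) : 0 < enorm2 x := by
  rw [enorm2_eq, norm_pos_iff]
  intro h; apply hx
  simpa using h

lemma enorm2_mulVec_le {n : ℕ} (A : Matrix (Fin n) (Fin n) ℂ) (x : Fin n → ℂ) :
    enorm2 (A *ᵥ x) ≤ opN A * enorm2 x := by
  rw [enorm2_eq, enorm2_eq, ← Matrix.toEuclideanCLM_toLp]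
  exact ContinuousLinearMap.le_opNorm _ _

lemma opN_le {n : ℕ} (A : Matrix (Fin n) (Fin n) ℂ) {c : ℝ} (hc : 0 ≤ c)
    (h : ∀ x, enorm2 x = 1 → enorm2 (A *ᵥ x) ≤ c) : opN A ≤ c := by
  apply ContinuousLinearMap.opNorm_le_bound _ hc
  intro x
  obtain ⟨x, rfl⟩ := (WithLp.equiv 2 (Fin n → ℂ)).symm.surjective x
  change ‖Matrix.toEuclideanCLM (n := Fin n) (𝕜 := ℂ) A (WithLp.toLp 2 x)‖ ≤ c * ‖(WithLp.toLp 2 x : EuclideanSpace ℂ (Fin n))‖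
  rw [Matrix.toEuclideanCLM_toLp, ← enorm2_eq, ← enorm2_eq]
  by_cases hx : x = 0
  · subst hx; simp [enorm2]
  have hp := enorm2_pos hx
  have h1 := h (((enorm2 x)⁻¹ : ℂ) • x) (by
    rw [enorm2_smul]; simp [abs_of_pos hp, hp.ne'])
  rw [Matrix.mulVec_smul, enorm2_smul] at h1
  simp only [norm_inv, Complex.norm_real, Real.norm_eq_abs, abs_of_pos hp] at h1
  rw [inv_mul_le_iff₀ hp] at h1
  linarith

lemma exists_unit {n : ℕ} (hn : 0 < n) : ∃ x : Fin n → ℂ, enorm2 x = 1 := by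
  refine ⟨Pi.single ⟨0, hn⟩ 1, ?_⟩
  rw [enorm2_eq]
  exact (PiLp.norm_single 2 (fun _ : Fin n => ℂ) ⟨0, hn⟩ 1).trans (by simp)

lemma specNorm_eq {n : ℕ} (hn : 0 < n) (A : Matrix (Fin n) (Fin n) ℂ) :
    specNorm A = opN A := by
  have hb : ∀ r ∈ {r : ℝ | ∃ x : Fin n → ℂ, enorm2 x = 1 ∧ r = enorm2 (A.mulVec x)},
      r ≤ opN A := by
    rintro r ⟨x, hx, rfl⟩
    simpa [hx] using enorm2_mulVec_le A x
  obtain ⟨x0, hx0⟩ := exists_unit hn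
  apply le_antisymm
  · exact csSup_le ⟨_, x0, hx0, rfl⟩ hb
  · apply opN_le
    · exact (enorm2_nonneg (A *ᵥ x0)).trans (le_csSup ⟨_, hb⟩ ⟨x0, hx0, rfl⟩)
    · intro x hx
      exact le_csSup ⟨_, hb⟩ ⟨x, hx, rfl⟩

lemma opN_smul {n : ℕ} (c : ℂ) (A : Matrix (Fin n) (Fin n) ℂ) :
    opN (c • A) = ‖c‖ * opN A := by
  unfold opN; rw [map_smul, norm_smul]

lemma opN_cont {n : ℕ} : Continuous (opN (n := n)) := by
  have := LinearMap.continuous_of_finiteDimensional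
    (Matrix.toEuclideanCLM (n := Fin n) (𝕜 := ℂ)).toAlgEquiv.toLinearMap
  exact this.norm

lemma smin_le {n : ℕ} (A : Matrix (Fin n) (Fin n) ℂ) {x : Fin n → ℂ} (hx : x ≠ 0) :
    sminSV A ≤ enorm2 (A *ᵥ x) / enorm2 x := by
  have hp := enorm2_pos hx
  apply csInf_le
  · exact ⟨0, by rintro r ⟨x, -, rfl⟩; exact enorm2_nonneg _⟩
  · refine ⟨((enorm2 x)⁻¹ : ℂ) • x, ?_, ?_⟩
    · rw [enorm2_smul]; simp [abs_of_pos hp, hp.ne']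
    · rw [Matrix.mulVec_smul, enorm2_smul]
      simp only [norm_inv, Complex.norm_real, Real.norm_eq_abs, abs_of_pos hp]
      field_simp

lemma smin_singular {n : ℕ} (A : Matrix (Fin n) (Fin n) ℂ) (h : A.det = 0) :
    sminSV A ≤ 0 := by
  obtain ⟨v, hv, h0⟩ := Matrix.exists_mulVec_eq_zero_iff.2 h
  have := smin_le A hv
  rw [h0] at this
  simpa [enorm2] using this

lemma smin_inv {n : ℕ} (hn : 0 < n) (A : Matrix (Fin n) (Fin n) ℂ) (h : A.det ≠ 0) :
    0 < opN A⁻¹ ∧ sminSV A = (opN A⁻¹)⁻¹ := by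
  have hu : IsUnit A.det := h.isUnit
  obtain ⟨x0, hx0⟩ := exists_unit hn
  have key : ∀ x, enorm2 x ≤ opN A⁻¹ * enorm2 (A *ᵥ x) := by
    intro x
    have := enorm2_mulVec_le A⁻¹ (A *ᵥ x)
    rwa [Matrix.mulVec_mulVec, Matrix.nonsing_inv_mul _ hu, Matrix.one_mulVec] at this
  have hpos : 0 < opN A⁻¹ := by
    have h0 : 0 ≤ opN A⁻¹ := norm_nonneg _
    rcases h0.eq_or_lt with h0 | h0
    · have := key x0
      rw [← h0, hx0] at this; linarith
    · exact h0
  refine ⟨hpos, ?_⟩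
  have hlow : (opN A⁻¹)⁻¹ ≤ sminSV A := by
    refine le_csInf (s := {r : ℝ | ∃ x : Fin n → ℂ, enorm2 x = 1 ∧ r = enorm2 (A.mulVec x)})
      ⟨_, x0, hx0, rfl⟩ ?_
    rintro r ⟨x, hx, rfl⟩
    rw [inv_le_iff_one_le_mul₀ hpos, mul_comm, ← hx]
    exact key x
  apply le_antisymm _ hlow
  have hs : 0 < sminSV A := (inv_pos.2 hpos).trans_le hlow
  rw [le_inv_comm₀ hs hpos]
  apply opN_le _ (inv_nonneg.2 hs.le)
  intro x hx
  have hx' : x ≠ 0 := by rintro rfl; simp [enorm2] at hx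
  have hz : A *ᵥ (A⁻¹ *ᵥ x) = x := by
    rw [Matrix.mulVec_mulVec, Matrix.mul_nonsing_inv _ hu, Matrix.one_mulVec]
  have hz' : A⁻¹ *ᵥ x ≠ 0 := by
    intro h0; rw [h0] at hz; simp at hz; exact hx' hz.symm
  have := smin_le A hz'
  rw [hz, hx] at this
  rw [le_inv_comm₀ (enorm2_pos hz') hs]
  simpa using this

lemma jordanN_pow {p : ℕ} (k : ℕ) (a b : Fin p) (h : (b : ℕ) < a + k) :
    (jordanN p ^ k) a b = 0 := by
  induction k generalizing b with
  | zero =>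
    rw [pow_zero, Matrix.one_apply_ne]
    rintro rfl; simp at h
  | succ k ih =>
    rw [pow_succ, Matrix.mul_apply]
    apply Finset.sum_eq_zero
    intro c _
    by_cases hc : (c : ℕ) < a + k
    · rw [ih c hc, zero_mul]
    · have : ¬ ((b : ℕ) = c + 1) := by omega
      simp [jordanN, this]

lemma jordanN_pow_self (p : ℕ) : jordanN p ^ p = 0 := by
  ext a b
  rw [jordanN_pow]; · rfl
  omega

/-- geometric sum -/
def gS (p : ℕ) (z : ℂ) : Matrix (Fin p) (Fin p) ℂ :=
  ∑ i ∈ Finset.range p, z ^ i • jordanN p ^ (p - 1 - i)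

lemma gS_mul (p : ℕ) (z : ℂ) :
    (z • (1 : Matrix (Fin p) (Fin p) ℂ) - jordanN p) * gS p z = z ^ p • 1 := by
  have hc : Commute (z • (1 : Matrix (Fin p) (Fin p) ℂ)) (jordanN p) :=
    (Commute.one_left _).smul_left z
  have := hc.mul_geom_sum₂ p
  rw [jordanN_pow_self, sub_zero] at this
  simpa [gS, smul_pow] using this

lemma gS_cont (p : ℕ) : Continuous (gS p) := by
  unfold gS; fun_prop

lemma gS_zero (p : ℕ) (hp : 1 ≤ p) : gS p 0 = jordanN p ^ (p - 1) := by
  obtain ⟨p, rfl⟩ : ∃ k, p = k + 1 := ⟨p - 1, by omega⟩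
  rw [gS, Finset.sum_range_succ']
  simp

lemma evalP_cont {n m : ℕ} (A : Fin (m+1) → Matrix (Fin n) (Fin n) ℂ) : Continuous (evalP A) := by
  unfold evalP; fun_prop

lemma detP_ne {n m : ℕ} (A : Fin (m+1) → Matrix (Fin n) (Fin n) ℂ)
    (hAm : (A (Fin.last m)).det ≠ 0) (l : ℂ) : ∀ᶠ μ in 𝓝[≠] l, (evalP A μ).det ≠ 0 := by
  have han : AnalyticOnNhd ℂ (fun μ => (evalP A μ).det) Set.univ := by
    apply DifferentiableOn.analyticOnNhd _ isOpen_univ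
    apply Differentiable.differentiableOn
    simp only [Matrix.det_apply, evalP, Matrix.sum_apply, Matrix.smul_apply]
    fun_prop
  by_contra hcon
  have hz := han.eqOn_zero_of_preconnected_of_frequently_eq_zero isPreconnected_univ
    (Set.mem_univ l) (by
      rw [Filter.not_eventually] at hcon
      exact hcon.mono (fun _ h => not_not.1 h))
  -- reversal
  let R : ℂ → Matrix (Fin n) (Fin n) ℂ := fun z => ∑ j : Fin (m+1), z ^ (m - (j : ℕ)) • A j
  have hR0 : R 0 = A (Fin.last m) := by
    simp only [R]
    rw [Finset.sum_eq_single (Fin.last m)]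
    · simp
    · intro b _ hb
      have : (b : ℕ) < m := Fin.val_lt_last hb
      rw [zero_pow (by omega), zero_smul]
    · simp
  have hRc : Continuous (fun z => (R z).det) := by
    apply Continuous.matrix_det; fun_prop
  have h1 : ∀ᶠ z in 𝓝[≠] (0 : ℂ), (R z).det ≠ 0 := by
    apply eventually_nhdsWithin_of_eventually_nhds
    apply hRc.continuousAt.eventually_ne
    rw [hR0]; exact hAm
  obtain ⟨z, hz1, hz0⟩ := (h1.and eventually_mem_nhdsWithin).exists
  have hz0 : z ≠ 0 := hz0
  apply hz1
  have : R z = z ^ m • evalP A z⁻¹ := by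
    simp only [R, evalP, Finset.smul_sum, smul_smul]
    refine Finset.sum_congr rfl fun j _ => ?_
    congr 1
    have : (j : ℕ) ≤ m := Fin.is_le j
    rw [pow_sub₀ _ hz0 this, inv_pow]
  rw [this, Matrix.det_smul]
  have h2 := hz (Set.mem_univ z⁻¹)
  simp only [Pi.zero_apply] at h2
  rw [h2, mul_zero]

lemma detJ_ne {q : ℕ} (Jt : Matrix (Fin q) (Fin q) ℂ) (l : ℂ) :
    ∀ᶠ μ in 𝓝[≠] l, (μ • (1 : Matrix (Fin q) (Fin q) ℂ) - Jt).det ≠ 0 := by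
  have := detP_ne (m := 1) ![-Jt, 1] (by simp [Fin.last]) l
  filter_upwards [this] with μ h
  simpa [evalP, Fin.sum_univ_two, sub_eq_neg_add] using h

lemma block_inv (lam0 : ℂ) (p0 κ0 q : ℕ) (Jt : Matrix (Fin q) (Fin q) ℂ) (μ : ℂ) (hμ : μ ≠ lam0)
    (h : (μ • (1 : Matrix (Fin q) (Fin q) ℂ) - Jt).det ≠ 0) :
    (μ - lam0) ^ p0 • (μ • (1 : Matrix ((Fin p0 × Fin κ0) ⊕ Fin q) ((Fin p0 × Fin κ0) ⊕ Fin q) ℂ) -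
          bigJ lam0 p0 κ0 q Jt)⁻¹ =
    Matrix.fromBlocks (Matrix.blockDiagonal fun _ : Fin κ0 => gS p0 (μ - lam0)) 0 0
      ((μ - lam0) ^ p0 • (μ • (1 : Matrix (Fin q) (Fin q) ℂ) - Jt)⁻¹) := by
  have hz : (μ - lam0) ^ p0 ≠ 0 := pow_ne_zero _ (sub_ne_zero.2 hμ)
  have hB : μ • (1 : Matrix ((Fin p0 × Fin κ0) ⊕ Fin q) ((Fin p0 × Fin κ0) ⊕ Fin q) ℂ) -
          bigJ lam0 p0 κ0 q Jt = Matrix.fromBlocks (Matrix.blockDiagonal fun _ : Fin κ0 =>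
            (μ - lam0) • (1 : Matrix (Fin p0) (Fin p0) ℂ) - jordanN p0) 0 0
            (μ • (1 : Matrix (Fin q) (Fin q) ℂ) - Jt) := by
    rw [bigJ, ← Matrix.fromBlocks_one, Matrix.fromBlocks_smul, sub_eq_add_neg, Matrix.fromBlocks_neg, Matrix.fromBlocks_add,
      ← Matrix.blockDiagonal_one, ← Matrix.blockDiagonal_smul, ← sub_eq_add_neg, ← sub_eq_add_neg,
      ← Matrix.blockDiagonal_sub]
    simp only [smul_zero, neg_zero, add_zero, sub_zero]
    congr 2
    funext i
    simp [sub_smul, sub_sub]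
  have hinv : (μ • (1 : Matrix ((Fin p0 × Fin κ0) ⊕ Fin q) ((Fin p0 × Fin κ0) ⊕ Fin q) ℂ) -
          bigJ lam0 p0 κ0 q Jt)⁻¹ = ((μ - lam0) ^ p0)⁻¹ •
    Matrix.fromBlocks (Matrix.blockDiagonal fun _ : Fin κ0 => gS p0 (μ - lam0)) 0 0
      ((μ - lam0) ^ p0 • (μ • (1 : Matrix (Fin q) (Fin q) ℂ) - Jt)⁻¹) := by
    apply Matrix.inv_eq_right_inv
    rw [hB, Matrix.mul_smul, Matrix.fromBlocks_multiply, ← Matrix.blockDiagonal_mul]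
    simp only [gS_mul, Matrix.mul_smul, Matrix.mul_nonsing_inv _ h.isUnit, Matrix.mul_zero,
      Matrix.zero_mul, add_zero, zero_add]
    rw [show (fun _ : Fin κ0 => (μ - lam0) ^ p0 • (1 : Matrix (Fin p0) (Fin p0) ℂ)) =
      (μ - lam0) ^ p0 • (1 : Fin κ0 → Matrix (Fin p0) (Fin p0) ℂ) from rfl,
      Matrix.blockDiagonal_smul, Matrix.blockDiagonal_one, Matrix.fromBlocks_smul]
    simp [smul_smul, hz]
  rw [hinv, smul_smul, mul_inv_cancel₀ hz, one_smul]

lemma res_tendsto {n : ℕ} (lam0 : ℂ) (p0 κ0 q : ℕ) (hp0 : 1 ≤ p0)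
    (X : Matrix (Fin n) ((Fin p0 × Fin κ0) ⊕ Fin q) ℂ)
    (Y : Matrix ((Fin p0 × Fin κ0) ⊕ Fin q) (Fin n) ℂ)
    (Jt : Matrix (Fin q) (Fin q) ℂ)
    (htilde : Filter.Tendsto
      (fun μ : ℂ => (μ - lam0) ^ p0 •
        (μ • (1 : Matrix (Fin q) (Fin q) ℂ) - Jt)⁻¹)
      (nhdsWithin lam0 {lam0}ᶜ) (nhds 0)) :
    Tendsto (fun μ : ℂ => (μ - lam0) ^ p0 •
      (X * (μ • (1 : Matrix ((Fin p0 × Fin κ0) ⊕ Fin q) ((Fin p0 × Fin κ0) ⊕ Fin q) ℂ) -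
          bigJ lam0 p0 κ0 q Jt)⁻¹ * Y)) (𝓝[≠] lam0) (𝓝 (X * bigD p0 κ0 q * Y)) := by
  have hg : Tendsto (fun μ => gS p0 (μ - lam0)) (𝓝[≠] lam0) (𝓝 (jordanN p0 ^ (p0 - 1))) := by
    rw [← gS_zero p0 hp0]
    apply tendsto_nhdsWithin_of_tendsto_nhds
    have : Continuous (fun μ => gS p0 (μ - lam0)) := (gS_cont p0).comp (by fun_prop)
    simpa using this.tendsto lam0
  have hF : Continuous (fun Z : Matrix (Fin p0) (Fin p0) ℂ × Matrix (Fin q) (Fin q) ℂ =>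
      X * Matrix.fromBlocks (Matrix.blockDiagonal fun _ : Fin κ0 => Z.1) 0 0 Z.2 * Y) := by
    refine Continuous.matrix_mul (Continuous.matrix_mul continuous_const ?_) continuous_const
    refine Continuous.matrix_fromBlocks ?_ continuous_const continuous_const continuous_snd
    apply Continuous.matrix_blockDiagonal
    fun_prop
  have := (hF.tendsto (jordanN p0 ^ (p0 - 1), 0)).comp (hg.prodMk_nhds htilde)
  refine Tendsto.congr' ?_ this
  filter_upwards [detJ_ne Jt lam0, eventually_mem_nhdsWithin] with μ h1 h2
  simp only [Function.comp]
  rw [← block_inv lam0 p0 κ0 q Jt μ h2 h1, Matrix.mul_smul, Matrix.smul_mul]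

end helpers

/-- Theorem 3.2: for a multiple eigenvalue `λ0` whose maximal Jordan
blocks have size `p0`, the Hausdorff distance between the connected component of the
`ε`-pseudospectrum containing `λ0` and the disc of radius `(K ε)^{1/p0}` about `λ0` is
`o(ε^{1/p0})` as `ε → 0⁺`, where `K = w(|λ0|) ‖X D Y‖` is the condition number of the
multiple eigenvalue. -/
theorem stmt9 {n m : ℕ}
    (A : Fin (m+1) → Matrix (Fin n) (Fin n) ℂ)
    (hAm : (A (Fin.last m)).det ≠ 0)
    (w : Fin (m+1) → ℝ) (hw : ∀ j, 0 ≤ w j) (hw0 : 0 < w 0)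
    (lam0 : ℂ) (heig : (evalP A lam0).det = 0)
    (p0 κ0 q : ℕ) (hp0 : 1 ≤ p0) (hκ0 : 1 ≤ κ0) (hq : κ0 * p0 + q = n * m)
    (X : Matrix (Fin n) ((Fin p0 × Fin κ0) ⊕ Fin q) ℂ)
    (Y : Matrix ((Fin p0 × Fin κ0) ⊕ Fin q) (Fin n) ℂ)
    (Jt : Matrix (Fin q) (Fin q) ℂ)
    (hres : ∀ μ : ℂ, (evalP A μ).det ≠ 0 →
      (evalP A μ)⁻¹ =
        X * (μ • (1 : Matrix ((Fin p0 × Fin κ0) ⊕ Fin q) ((Fin p0 × Fin κ0) ⊕ Fin q) ℂ) -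
          bigJ lam0 p0 κ0 q Jt)⁻¹ * Y)
    (htilde : Filter.Tendsto
      (fun μ : ℂ => (μ - lam0) ^ p0 •
        (μ • (1 : Matrix (Fin q) (Fin q) ℂ) - Jt)⁻¹)
      (nhdsWithin lam0 {lam0}ᶜ) (nhds 0))
    (hK : 0 < wval w ‖lam0‖ * specNorm (X * bigD p0 κ0 q * Y)) :
    Filter.Tendsto
      (fun ε : ℝ =>
        Metric.hausdorffDist
            (connectedComponentIn
              {μ : ℂ | sminSV (evalP A μ) ≤ ε * wval w ‖μ‖} lam0)
            (Metric.closedBall lam0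
              ((wval w ‖lam0‖ * specNorm (X * bigD p0 κ0 q * Y) * ε) ^
                (1 / (p0 : ℝ)))) /
          ε ^ (1 / (p0 : ℝ)))
      (nhdsWithin 0 (Set.Ioi 0)) (nhds 0) := by
  classical
  have hn : 0 < n := by
    rcases Nat.eq_zero_or_pos n with h | h
    · subst h; simp at heig
    · exact h
  have hwpos : ∀ t : ℝ, 0 ≤ t → 0 < wval w t := by
    intro t ht
    unfold wval
    rw [Fin.sum_univ_succ]
    have : 0 ≤ ∑ i : Fin m, w i.succ * t ^ ((i.succ : Fin (m+1)) : ℕ) :=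
      Finset.sum_nonneg fun i _ => mul_nonneg (hw _) (pow_nonneg ht _)
    simp only [Fin.val_zero, pow_zero, mul_one]
    linarith
  have hwc : Continuous (fun μ : ℂ => wval w ‖μ‖) := by unfold wval; fun_prop
  set M := X * bigD p0 κ0 q * Y with hM
  set K := wval w ‖lam0‖ * specNorm M with hKdef
  have hMpos : 0 < opN M := by
    rw [← specNorm_eq hn]
    exact pos_of_mul_pos_right hK (hwpos _ (norm_nonneg _)).le
  have hlim : Filter.Tendsto (fun μ => K / (wval w ‖μ‖ * opN ((μ - lam0) ^ p0 • (evalP A μ)⁻¹)))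
      (nhdsWithin lam0 {lam0}ᶜ) (nhds 1) := by
    have h1 : Filter.Tendsto (fun μ => (μ - lam0) ^ p0 • (evalP A μ)⁻¹)
        (nhdsWithin lam0 {lam0}ᶜ) (nhds M) := by
      refine Filter.Tendsto.congr' ?_ (res_tendsto lam0 p0 κ0 q hp0 X Y Jt htilde)
      filter_upwards [detP_ne A hAm lam0] with μ hμ
      rw [hres μ hμ]
    have h2 := (opN_cont.tendsto M).comp h1
    have h3 : Filter.Tendsto (fun μ : ℂ => wval w ‖μ‖) (nhdsWithin lam0 {lam0}ᶜ)
        (nhds (wval w ‖lam0‖)) := tendsto_nhdsWithin_of_tendsto_nhds (hwc.tendsto lam0)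
    have hK1 : K = wval w ‖lam0‖ * opN M := by rw [hKdef, specNorm_eq hn]
    have h4 := (tendsto_const_nhds (x := K)).div (h3.mul h2) (by rw [← hK1]; exact hK.ne')
    rw [← hK1, div_self hK.ne'] at h4
    exact h4
  have hp0R : (p0 : ℝ) ≠ 0 := by positivity
  rw [Metric.tendsto_nhds]
  intro e he
  -- choice of `δ`
  have hKp : 0 < K ^ (1 / (p0 : ℝ)) := Real.rpow_pos_of_pos hK _
  obtain ⟨δ, hδ0, hδ1, hδe⟩ : ∃ δ : ℝ, 0 < δ ∧ δ < 1 ∧ δ * K ^ (1 / (p0 : ℝ)) < e := by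
    refine ⟨min (1/2) (e / (2 * K ^ (1 / (p0 : ℝ)))), by positivity, ?_, ?_⟩
    · exact (min_le_left _ _).trans_lt (by norm_num)
    · calc _ ≤ e / (2 * K ^ (1 / (p0 : ℝ))) * K ^ (1 / (p0 : ℝ)) := by
            gcongr; exact min_le_right _ _
        _ = e / 2 := by field_simp
        _ < e := by linarith
  have hlo : ((1 + δ) ^ p0)⁻¹ < 1 := inv_lt_one_of_one_lt₀ (one_lt_pow₀ (by linarith) (by omega))
  have hhi : 1 < ((1 - δ) ^ p0)⁻¹ := by
    rw [one_lt_inv₀ (by have : 0 < 1 - δ := by linarith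
                        positivity)]
    exact pow_lt_one₀ (by linarith) (by linarith) (by omega)
  have hev : ∀ᶠ μ in nhdsWithin lam0 {lam0}ᶜ,
      ‖μ - lam0‖ ^ p0 * wval w ‖μ‖ ≤ (1 + δ) ^ p0 * (K * sminSV (evalP A μ)) ∧
      (1 - δ) ^ p0 * (K * sminSV (evalP A μ)) ≤ ‖μ - lam0‖ ^ p0 * wval w ‖μ‖ := by
    filter_upwards [hlim.eventually (lt_mem_nhds hlo), hlim.eventually (gt_mem_nhds hhi),
      detP_ne A hAm lam0, eventually_mem_nhdsWithin] with μ h1 h2 h3 h4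
    have h4 : 0 < ‖μ - lam0‖ := norm_pos_iff.2 (sub_ne_zero.2 h4)
    obtain ⟨hs0, hs⟩ := smin_inv hn _ h3
    have hwμ := hwpos ‖μ‖ (norm_nonneg _)
    have hd : 0 < 1 - δ := by linarith
    have hzp : 0 < ‖μ - lam0‖ ^ p0 := by positivity
    rw [opN_smul, norm_pow] at h1 h2
    have e1 : K / (wval w ‖μ‖ * (‖μ - lam0‖ ^ p0 * opN (evalP A μ)⁻¹)) =
        (K * sminSV (evalP A μ)) / (‖μ - lam0‖ ^ p0 * wval w ‖μ‖) := by
      rw [hs]; field_simp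
    rw [e1] at h1 h2
    constructor
    · rw [lt_div_iff₀ (by positivity), inv_mul_lt_iff₀ (by positivity)] at h1
      exact h1.le
    · rw [div_lt_iff₀ (by positivity), lt_inv_mul_iff₀ (by positivity)] at h2
      exact h2.le
  rw [eventually_nhdsWithin_iff, Metric.eventually_nhds_iff] at hev
  obtain ⟨r, hr, hev⟩ := hev
  -- small ε
  have hsmall : ∀ᶠ ε : ℝ in nhdsWithin 0 (Set.Ioi 0),
      (1 + δ) * (K * ε) ^ (1 / (p0 : ℝ)) < r := by
    apply eventually_nhdsWithin_of_eventually_nhds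
    have hc : ContinuousAt (fun ε : ℝ => (1 + δ) * (K * ε) ^ (1 / (p0 : ℝ))) 0 := by
      apply ContinuousAt.mul continuousAt_const
      apply ContinuousAt.rpow_const (by fun_prop)
      right; positivity
    apply hc.eventually_lt continuousAt_const
    simp only [mul_zero]
    rw [Real.zero_rpow (by positivity), mul_zero]
    exact hr
  filter_upwards [hsmall, eventually_mem_nhdsWithin] with ε hεr hε
  have hε : 0 < ε := hε
  set R := (K * ε) ^ (1 / (p0 : ℝ)) with hR
  have hRpos : 0 < R := Real.rpow_pos_of_pos (mul_pos hK hε) _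
  have hRp : R ^ p0 = K * ε := by
    rw [hR, ← Real.rpow_natCast, ← Real.rpow_mul (mul_pos hK hε).le, one_div,
      inv_mul_cancel₀ hp0R, Real.rpow_one]
  set S := {μ : ℂ | sminSV (evalP A μ) ≤ ε * wval w ‖μ‖} with hS
  have hd : 0 < 1 - δ := by linarith
  have hlamS : lam0 ∈ S :=
    (smin_singular _ heig).trans (mul_nonneg hε.le (hwpos _ (norm_nonneg _)).le)
  have hsub1 : ∀ μ ∈ S, dist μ lam0 < r → dist μ lam0 ≤ (1 + δ) * R := by
    intro μ hμ hμr
    by_cases hne : μ = lam0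
    · subst hne; rw [dist_self]; positivity
    have h1 := (hev hμr hne).1
    have hwμ := hwpos ‖μ‖ (norm_nonneg _)
    have h2 : ‖μ - lam0‖ ^ p0 * wval w ‖μ‖ ≤ ((1 + δ) * R) ^ p0 * wval w ‖μ‖ := by
      calc _ ≤ (1 + δ) ^ p0 * (K * sminSV (evalP A μ)) := h1
        _ ≤ (1 + δ) ^ p0 * (K * (ε * wval w ‖μ‖)) := by gcongr; exact hμ
        _ = _ := by rw [mul_pow, hRp]; ring
    rw [dist_eq_norm]
    exact le_of_pow_le_pow_left₀ (by omega) (by positivity) (le_of_mul_le_mul_right h2 hwμ)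
  have hsub2 : Metric.closedBall lam0 ((1 - δ) * R) ⊆ S := by
    intro μ hμ
    by_cases hne : μ = lam0
    · rw [hne]; exact hlamS
    rw [Metric.mem_closedBall] at hμ
    have hμr : dist μ lam0 < r := by nlinarith
    have h1 := (hev hμr hne).2
    have hwμ := hwpos ‖μ‖ (norm_nonneg _)
    rw [dist_eq_norm] at hμ
    have h2 : (1 - δ) ^ p0 * K * sminSV (evalP A μ) ≤ (1 - δ) ^ p0 * K * (ε * wval w ‖μ‖) := by
      calc _ = (1 - δ) ^ p0 * (K * sminSV (evalP A μ)) := by ring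
        _ ≤ _ := h1
        _ ≤ ((1 - δ) * R) ^ p0 * wval w ‖μ‖ := by gcongr
        _ = _ := by rw [mul_pow, hRp]; ring
    exact le_of_mul_le_mul_left h2 (by positivity)
  set G := connectedComponentIn S lam0 with hG
  have hG2 : Metric.closedBall lam0 ((1 - δ) * R) ⊆ G :=
    (convex_closedBall lam0 _).isPreconnected.subset_connectedComponentIn
      (Metric.mem_closedBall_self (by positivity)) hsub2
  have hG1 : ∀ μ ∈ G, dist μ lam0 ≤ (1 + δ) * R := by
    intro μ hμ
    by_contra hcon
    push Not at hcon
    obtain ⟨ν, hν, hν1, hν2⟩ := isPreconnected_connectedComponentIn (F := S) (x := lam0)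
      (Metric.ball lam0 r) (Metric.closedBall lam0 ((1 + δ) * R))ᶜ Metric.isOpen_ball
      Metric.isClosed_closedBall.isOpen_compl
      (fun x _ => by
        by_cases hx : dist x lam0 < r
        · left; exact hx
        · right; simp only [Set.mem_compl_iff, Metric.mem_closedBall]; linarith)
      ⟨lam0, mem_connectedComponentIn hlamS, Metric.mem_ball_self hr⟩
      ⟨μ, hμ, by simpa using hcon⟩
    exact hν2 (hsub1 ν (connectedComponentIn_subset _ _ hν) hν1)
  have hH : Metric.hausdorffDist G (Metric.closedBall lam0 R) ≤ δ * R := by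
    apply Metric.hausdorffDist_le_of_mem_dist (by positivity)
    · intro x hx
      have h1 := hG1 x hx
      rw [dist_eq_norm] at h1
      refine ⟨lam0 + ((1 + δ)⁻¹ : ℝ) • (x - lam0), ?_, ?_⟩
      · rw [Metric.mem_closedBall, dist_eq_norm, add_sub_cancel_left, norm_smul,
          Real.norm_of_nonneg (by positivity), inv_mul_le_iff₀ (by positivity)]
        exact h1
      · have : x - (lam0 + ((1 + δ)⁻¹ : ℝ) • (x - lam0)) = (δ * (1 + δ)⁻¹ : ℝ) • (x - lam0) := by
          have : (δ * (1 + δ)⁻¹ : ℝ) = 1 - (1 + δ)⁻¹ := by field_simp; ring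
          rw [this, sub_smul, one_smul]; abel
        rw [dist_eq_norm, this, norm_smul, Real.norm_of_nonneg (by positivity), mul_assoc]
        gcongr
        rw [inv_mul_le_iff₀ (by positivity)]
        exact h1
    · intro x hx
      rw [Metric.mem_closedBall, dist_eq_norm] at hx
      refine ⟨lam0 + (1 - δ) • (x - lam0), hG2 ?_, ?_⟩
      · rw [Metric.mem_closedBall, dist_eq_norm, add_sub_cancel_left, norm_smul,
          Real.norm_of_nonneg hd.le]
        gcongr
      · have : x - (lam0 + (1 - δ) • (x - lam0)) = δ • (x - lam0) := by
          rw [sub_smul, one_smul]; abel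
        rw [dist_eq_norm, this, norm_smul, Real.norm_of_nonneg hδ0.le]
        gcongr
  have hεp : 0 < ε ^ (1 / (p0 : ℝ)) := Real.rpow_pos_of_pos hε _
  rw [dist_zero_right, Real.norm_of_nonneg (div_nonneg Metric.hausdorffDist_nonneg hεp.le),
    div_lt_iff₀ hεp]
  calc _ ≤ δ * R := hH
    _ = δ * K ^ (1 / (p0 : ℝ)) * ε ^ (1 / (p0 : ℝ)) := by
      rw [hR, Real.mul_rpow hK.le hε.le]; ring
    _ < e * ε ^ (1 / (p0 : ℝ)) := by gcongr
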